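/- Let H be a real Hilbert space, f : H → ℝ a continuously differentiable function with gradient ∇f, and K a continuous map assigning to each w ∈ H a continuous linear operator K(w) : H → H that is symmetric with respect to the inner product and satisfies ‖K(w)‖ < 1/2. Let a ≤ b be real numbers and let ε > 0 and C > 0 be constants such that every x ∈ H with a ≤ f(x) ≤ b and ‖∇f(x)‖ ≤ ε satisfies ‖x‖ ≤ C. Let w : ℝ → H be a differentiable curve satisfying w'(t) = −∇f(w(t)) − K(w(t))(∇f(w(t))) for all t, with a ≤ f(w(t)) ≤ b for all t ∈ ℝ, and suppose ‖∇f(w(t))‖ → 0 as t → +∞. Then ‖w(t)‖ ≤ C + 5·(b − a)/ε for all t ∈ ℝ. -/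

import Mathlib

open scoped RealInnerProductSpace

/-- Proposition 3.2 (abstract form): flow lines of the perturbed negative gradient
flow with action values in `[a, b]` are uniformly bounded, given the
Palais–Smale-type a priori bound of Corollary 3.1. -/
theorem perturbed_gradient_flow_uniform_bound
    {H : Type*} [NormedAddCommGroup H] [InnerProductSpace ℝ H] [CompleteSpace H]
    (f : H → ℝ) (hf : ContDiff ℝ 1 f)
    (K : H → H →L[ℝ] H) (hKcont : Continuous K)
    (hKsym : ∀ w u v : H, ⟪K w u, v⟫ = ⟪u, K w v⟫)
    (hKnorm : ∀ w : H, ‖K w‖ < 1 / 2)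
    (a b : ℝ) (hab : a ≤ b)
    (ε C : ℝ) (hε : 0 < ε) (hC : 0 < C)
    (hPS : ∀ x : H, a ≤ f x → f x ≤ b → ‖gradient f x‖ ≤ ε → ‖x‖ ≤ C)
    (w : ℝ → H)
    (hw : ∀ t : ℝ, HasDerivAt w (-(gradient f (w t)) - K (w t) (gradient f (w t))) t)
    (hfw : ∀ t : ℝ, a ≤ f (w t) ∧ f (w t) ≤ b)
    (hlim : Filter.Tendsto (fun t : ℝ => ‖gradient f (w t)‖) Filter.atTop (nhds 0)) :
    ∀ t : ℝ, ‖w t‖ ≤ C + 5 * (b - a) / ε := by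
  have hgcont : Continuous (fun x => gradient f x) := by
    unfold gradient
    exact (LinearIsometryEquiv.continuous _).comp (hf.continuous_fderiv one_ne_zero)
  have hwcont : Continuous w := continuous_iff_continuousAt.2 fun t => (hw t).continuousAt
  have hg : Continuous (fun t => ‖gradient f (w t)‖) := (hgcont.comp hwcont).norm
  have hfd : ∀ t, HasDerivAt (fun s => f (w s))
      ⟪gradient f (w t), -(gradient f (w t)) - K (w t) (gradient f (w t))⟫ t := by
    intro t
    have h1 : HasGradientAt f (gradient f (w t)) (w t) :=
      ((hf.differentiable one_ne_zero) (w t)).hasGradientAt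
    have h2 := h1.hasFDerivAt.comp_hasDerivAt t (hw t)
    exact h2
  intro t
  let S : Set ℝ := {s | t ≤ s ∧ ‖gradient f (w s)‖ ≤ ε}
  have hSc : IsClosed S :=
    (isClosed_le continuous_const continuous_id).inter (isClosed_le hg continuous_const)
  have hSne : S.Nonempty := by
    obtain ⟨s, h1, h2⟩ :=
      ((hlim.eventually (ge_mem_nhds hε)).and (Filter.eventually_ge_atTop t)).exists
    exact ⟨s, h2, h1⟩
  have hSb : BddBelow S := ⟨t, fun s hs => hs.1⟩
  obtain ⟨hT1, hT2⟩ : sInf S ∈ S := hSc.csInf_mem hSne hSb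
  set T := sInf S with hT
  have hout : ∀ s ∈ Set.Ico t T, ε < ‖gradient f (w s)‖ := by
    intro s hs
    by_contra h
    have : T ≤ s := csInf_le hSb ⟨hs.1, not_lt.1 h⟩
    exact absurd hs.2 (not_lt.2 this)
  have key : ‖w T - w t‖ ≤ (3 / ε) * (f (w t) - f (w T)) := by
    refine image_norm_le_of_norm_deriv_right_le_deriv_boundary
      (f := fun s => w s - w t) (a := t) (b := T)
      (f' := fun s => -(gradient f (w s)) - K (w s) (gradient f (w s)))
      (B := fun s => (3 / ε) * (f (w t) - f (w s)))
      (B' := fun s => (3 / ε) *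
        (-⟪gradient f (w s), -(gradient f (w s)) - K (w s) (gradient f (w s))⟫))
      (by fun_prop) (fun s _ => ((hw s).sub_const _).hasDerivWithinAt) (by simp)
      (fun s => ((hfd s).const_sub _).const_mul _) ?_ ⟨hT1, le_rfl⟩
    intro s hs
    have hs' := hout s hs
    set g := gradient f (w s)
    have hK : ‖K (w s) g‖ ≤ 1 / 2 * ‖g‖ := (K (w s)).le_of_opNorm_le (hKnorm _).le g
    have h1 : ‖-g - K (w s) g‖ ≤ 3 / 2 * ‖g‖ := by
      have := norm_sub_le (-g) (K (w s) g)
      rw [norm_neg] at this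
      linarith
    have h2 : 1 / 2 * ‖g‖ ^ 2 ≤ -⟪g, -g - K (w s) g⟫ := by
      rw [inner_sub_right, inner_neg_right, real_inner_self_eq_norm_sq]
      have h3 := (abs_le.1 (abs_real_inner_le_norm g (K (w s) g))).1
      nlinarith [mul_le_mul_of_nonneg_left hK (norm_nonneg g)]
    refine h1.trans ?_
    rw [div_mul_eq_mul_div 3 ε, le_div_iff₀ hε]
    nlinarith [mul_le_mul_of_nonneg_left hs'.le (norm_nonneg g)]
  have hwT : ‖w T‖ ≤ C := hPS _ (hfw T).1 (hfw T).2 hT2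
  have h3 : ‖w t‖ ≤ ‖w T‖ + ‖w T - w t‖ := by
    rw [norm_sub_rev]; simpa [add_comm] using norm_add_le (w T) (w t - w T)
  have h4 : (3 / ε) * (f (w t) - f (w T)) ≤ 5 * (b - a) / ε := by
    rw [div_mul_eq_mul_div]
    apply div_le_div_of_nonneg_right _ hε.le
    linarith [(hfw T).1, (hfw t).2]
  linarith
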